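/- arXiv:1708.03013 — 2 statements merged into one kernel-verified Lean document; each statement's English description precedes it below -/
import Mathlib

section
/- Let R be a commutative ring and let z, y, ϖ ∈ R. Set ν := 1 + ϖ·z·y and ν' := 1 − ϖ·z·y, and assume ν and ν' are units of R. Then in the 2×2 matrices over R one has both factorizations: !![0,1;-1,0] · !![1,z;0,1] · !![1,0;ϖ·y,1] = !![1, −ϖ·y·ν⁻¹; 0,1] · !![ν⁻¹,0;0,ν] · !![1,0; ϖ·z²·y·ν⁻¹, 1] · !![0,1;-1,0] · !![1,z;0,1], and !![0,1;-1,0] · !![1,z;0,1] · !![1,0;ϖ·y,1] = !![1,0; ϖ·z²·y·ν'⁻¹, 1] · !![ν',0;0,ν'⁻¹] · !![1, −ϖ·y·ν'⁻¹; 0,1] · !![0,1;-1,0] · !![1,z;0,1]. -/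
/-- Conjugating a lower unipotent matrix by `!![0, 1; -1, 0] * !![1, z; 0, 1]`. -/
theorem weyl_mul_upper_mul_lower {R : Type*} [CommRing R] (z c : R) :
    !![0, 1; -1, 0] * !![1, z; 0, 1] * !![1, 0; c, 1] =
      !![1 - c * z, -c; c * z ^ 2, 1 + c * z] * !![0, 1; -1, 0] * !![1, z; 0, 1] := by
  ext i j
  fin_cases i <;> fin_cases j <;> simp <;> ring

/-- The upper-diagonal-lower factorization of a matrix of determinant one whose lower right
entry is a unit. -/
theorem upper_mul_diag_mul_lower {R : Type*} [CommRing R] {a b c : R} {d : Rˣ}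
    (h : a * d - b * c = 1) :
    !![1, b * ↑d⁻¹; 0, 1] * !![(↑d⁻¹ : R), 0; 0, ↑d] * !![1, 0; c * ↑d⁻¹, 1] =
      !![a, b; c, ↑d] := by
  have hd : (d : R) * ↑d⁻¹ = 1 := d.mul_inv
  ext i j
  fin_cases i <;> fin_cases j <;> simp
  · linear_combination (-(↑d⁻¹ : R)) * h + a * hd
  · linear_combination c * hd

/-- The lower-diagonal-upper factorization of a matrix of determinant one whose upper left
entry is a unit. -/
theorem lower_mul_diag_mul_upper {R : Type*} [CommRing R] {a : Rˣ} {b c d : R}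
    (h : a * d - b * c = 1) :
    !![1, 0; c * ↑a⁻¹, 1] * !![(↑a : R), 0; 0, ↑a⁻¹] * !![1, b * ↑a⁻¹; 0, 1] =
      !![↑a, b; c, d] := by
  have ha : (a : R) * ↑a⁻¹ = 1 := a.mul_inv
  ext i j
  fin_cases i <;> fin_cases j <;> simp
  · linear_combination b * ha
  · linear_combination (-(↑a⁻¹ : R)) * h + d * ha

/-- The SL₂-computations proving Lemma 4.1(c) of the paper (opposite affine roots):
with `ν = 1 + ϖ·z·y` and `ν' = 1 − ϖ·z·y` invertible,
`!![0,1;-1,0] · !![1,z;0,1] · !![1,0;ϖ·y,1]` factors in the two stated ways. -/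
theorem opposite_affine_root_factorizations {R : Type*} [CommRing R] (z y ϖ : R) (ν ν' : Rˣ)
    (hν : (ν : R) = 1 + ϖ * z * y) (hν' : (ν' : R) = 1 - ϖ * z * y) :
    (!![0, 1; -1, 0] * !![1, z; 0, 1] * !![1, 0; ϖ * y, 1] =
      !![1, -(ϖ * y * ((ν⁻¹ : Rˣ) : R)); 0, 1] * !![((ν⁻¹ : Rˣ) : R), 0; 0, (ν : R)] *
        !![1, 0; ϖ * z ^ 2 * y * ((ν⁻¹ : Rˣ) : R), 1] *
          !![0, 1; -1, 0] * !![1, z; 0, 1]) ∧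
    (!![0, 1; -1, 0] * !![1, z; 0, 1] * !![1, 0; ϖ * y, 1] =
      !![1, 0; ϖ * z ^ 2 * y * ((ν'⁻¹ : Rˣ) : R), 1] * !![(ν' : R), 0; 0, ((ν'⁻¹ : Rˣ) : R)] *
        !![1, -(ϖ * y * ((ν'⁻¹ : Rˣ) : R)); 0, 1] *
          !![0, 1; -1, 0] * !![1, z; 0, 1]) := by
  have hνν' : (ν' : R) * ν - -(ϖ * y) * (ϖ * z ^ 2 * y) = 1 := by
    rw [hν, hν']; ring
  have hM : !![1 - ϖ * y * z, -(ϖ * y); ϖ * y * z ^ 2, 1 + ϖ * y * z] =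
      !![(ν' : R), -(ϖ * y); ϖ * z ^ 2 * y, ν] := by
    rw [hν, hν']
    ext i j
    fin_cases i <;> fin_cases j <;> simp <;> ring
  rw [weyl_mul_upper_mul_lower, hM, ← neg_mul _ (↑ν⁻¹ : R), ← neg_mul _ (↑ν'⁻¹ : R),
    upper_mul_diag_mul_lower hνν', lower_mul_diag_mul_upper hνν']
  exact ⟨rfl, rfl⟩
end

section
/- Let p ≥ 5 be a prime and let I₁ be the pro-p Iwahori subgroup of SL₂(ℤ_p), i.e. the subgroup of matrices A ∈ SL₂(ℤ_p) with A₀₀ − 1 ∈ pℤ_p, A₁₁ − 1 ∈ pℤ_p and A₁₀ ∈ pℤ_p. Then I₁ is torsion-free: if A ∈ I₁ and Aⁿ = 1 for some integer n ≥ 1, then A = 1. -/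
open Matrix

/-- The matrices that are strictly upper-triangular modulo `π`. -/
def strictUpperMod {R : Type*} [CommRing R] (π : R) :
    NonUnitalSubalgebra R (Matrix (Fin 2) (Fin 2) R) where
  carrier := {M | π ∣ M 0 0 ∧ π ∣ M 1 1 ∧ π ∣ M 1 0}
  zero_mem' := by simp
  add_mem' := fun ⟨h₀, h₁, h₂⟩ ⟨k₀, k₁, k₂⟩ => ⟨dvd_add h₀ k₀, dvd_add h₁ k₁, dvd_add h₂ k₂⟩
  smul_mem' := fun c _ ⟨h₀, h₁, h₂⟩ =>
    ⟨Dvd.dvd.mul_left h₀ c, Dvd.dvd.mul_left h₁ c, Dvd.dvd.mul_left h₂ c⟩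
  mul_mem' := by
    rintro M K ⟨h₀, h₁, h₂⟩ ⟨k₀, k₁, k₂⟩
    simp only [Set.mem_ofPred_eq, Matrix.mul_apply, Fin.sum_univ_two]
    exact ⟨dvd_add (h₀.mul_right _) (k₂.mul_left _), dvd_add (h₂.mul_right _) (k₁.mul_left _),
      dvd_add (h₂.mul_right _) (k₂.mul_left _)⟩

theorem mem_strictUpperMod {R : Type*} [CommRing R] {π : R} {M : Matrix (Fin 2) (Fin 2) R} :
    M ∈ strictUpperMod π ↔ π ∣ M 0 0 ∧ π ∣ M 1 1 ∧ π ∣ M 1 0 :=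
  Iff.rfl

theorem pow_succ_mem_strictUpperMod {R : Type*} [CommRing R] {π : R}
    {N : Matrix (Fin 2) (Fin 2) R} (hN : N ∈ strictUpperMod π) (k : ℕ) :
    N ^ (k + 1) ∈ strictUpperMod π := by
  induction k with
  | zero => simpa using hN
  | succ k ih => rw [pow_succ]; exact mul_mem ih hN

theorem exists_cube_eq_smul {R : Type*} [CommRing R] {π : R}
    {N : Matrix (Fin 2) (Fin 2) R} (hN : N ∈ strictUpperMod π) :
    ∃ K ∈ strictUpperMod π, N ^ 3 = π • K := by
  obtain ⟨⟨a, ha⟩, ⟨d, hd⟩, ⟨c, hc⟩⟩ := hN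
  have hN' : N = !![π * a, N 0 1; π * c, π * d] := by
    rw [← ha, ← hd, ← hc]; exact Matrix.eta_fin_two N
  generalize N 0 1 = b at hN'
  subst hN'
  refine ⟨!![π * a, b; π * c, π * d] * !![π * a ^ 2 + b * c, b * (a + d);
    π * (c * (a + d)), π * d ^ 2 + b * c], ?_, ?_⟩
  · rw [mem_strictUpperMod]
    simp only [Matrix.mul_apply, Fin.sum_univ_two, Matrix.of_apply, Matrix.cons_val_zero,
      Matrix.cons_val_one]
    exact ⟨⟨a * (π * a ^ 2 + b * c) + b * (c * (a + d)), by ring⟩,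
      ⟨c * (b * (a + d)) + d * (π * d ^ 2 + b * c), by ring⟩,
      ⟨c * (π * a ^ 2 + b * c) + d * (π * (c * (a + d))), by ring⟩⟩
  · rw [pow_succ', sq, ← Matrix.mul_smul]
    congr 1
    ext i j
    fin_cases i <;> fin_cases j <;> simp [Matrix.mul_apply] <;> ring

theorem exists_pow_eq_smul {R : Type*} [CommRing R] {π : R}
    {N : Matrix (Fin 2) (Fin 2) R} (hN : N ∈ strictUpperMod π) {k : ℕ} (hk : 3 ≤ k) :
    ∃ K ∈ strictUpperMod π, N ^ k = π • K := by
  induction k, hk using Nat.le_induction with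
  | base => exact exists_cube_eq_smul hN
  | succ k _ ih =>
    obtain ⟨K, hK, h⟩ := ih
    exact ⟨K * N, mul_mem hK hN, by rw [pow_succ, h, Matrix.smul_mul]⟩

theorem eq_zero_of_mul_smul_one_add_eq_zero {R : Type*} [CommRing R] [IsDomain R] {π c : R}
    (hπ : Prime π) (hc : ¬ π ∣ c) {N K : Matrix (Fin 2) (Fin 2) R} (hK : K ∈ strictUpperMod π)
    (h : N * (c • 1 + K) = 0) : N = 0 := by
  have hdet : (c • 1 + K).det ≠ 0 := by
    intro h0
    obtain ⟨⟨a, ha⟩, ⟨d, hd⟩, ⟨e, he⟩⟩ := hK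
    simp only [Matrix.det_fin_two, Matrix.add_apply, Matrix.smul_apply, Matrix.one_apply_eq,
      ha, hd, he, smul_eq_mul, ne_eq, zero_ne_one, one_ne_zero, not_false_eq_true,
      Matrix.one_apply_ne] at h0
    refine hc (hπ.dvd_of_dvd_pow (n := 2) ⟨-(a * c + c * d + π * a * d - K 0 1 * e), ?_⟩)
    linear_combination h0
  have := congrArg (· * (c • 1 + K).adjugate) h
  simpa [Matrix.mul_assoc, Matrix.mul_adjugate, hdet] using this

theorem one_add_pow_eq {R : Type*} [Ring R] (x : R) (m : ℕ) :
    (1 + x) ^ (m + 1) = 1 + x * ((m + 1 : ℕ) +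
      ∑ k ∈ Finset.range m, (m + 1).choose (k + 2) • x ^ (k + 1)) := by
  rw [add_comm 1 x, (Commute.one_right x).add_pow, Finset.sum_range_succ', Finset.sum_range_succ',
    mul_add, Finset.mul_sum]
  simp only [one_pow, mul_one, zero_add, pow_zero, pow_one, Nat.choose_zero_right, Nat.cast_one,
    Nat.choose_one_right, nsmul_eq_mul, Nat.cast_comm, ← mul_assoc, ← pow_succ']
  abel

theorem eq_zero_of_one_add_pow_prime_eq_one {p : ℕ} [Fact p.Prime] (hp : 5 ≤ p)
    {N : Matrix (Fin 2) (Fin 2) ℤ_[p]} (hN : N ∈ strictUpperMod (p : ℤ_[p]))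
    {q : ℕ} (hq : q.Prime) (h : (1 + N) ^ q = 1) : N = 0 := by
  have hpp : p.Prime := Fact.out
  obtain ⟨m, rfl⟩ : ∃ m, q = m + 1 := ⟨q - 1, by have := hq.pos; omega⟩
  rw [one_add_pow_eq, add_eq_left] at h
  have hcast (c : ℕ) :
      (c : Matrix (Fin 2) (Fin 2) ℤ_[p]) = (c : ℤ_[p]) • 1 := by
    rw [Nat.cast_smul_eq_nsmul, nsmul_one]
  rw [hcast] at h
  by_cases hqp : m + 1 = p
  · have hterm : ∀ k ∈ Finset.range m, ∃ K ∈ strictUpperMod (p : ℤ_[p]),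
        (m + 1).choose (k + 2) • N ^ (k + 1) = (p : ℤ_[p]) • K := by
      intro k hk
      rw [Finset.mem_range] at hk
      by_cases hkm : k + 1 = m
      · obtain ⟨K, hK, h'⟩ := exists_pow_eq_smul hN (k := k + 1) (by omega)
        exact ⟨K, hK, by rw [show k + 2 = m + 1 by omega, Nat.choose_self, one_smul, h']⟩
      · obtain ⟨c, hc⟩ : p ∣ (m + 1).choose (k + 2) := by
          rw [hqp]; exact hpp.dvd_choose_self (by omega) (by omega)
        refine ⟨c • N ^ (k + 1), nsmul_mem (pow_succ_mem_strictUpperMod hN k) c, ?_⟩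
        rw [hc, Nat.cast_smul_eq_nsmul, mul_smul]
    choose! K hK hNK using hterm
    rw [Finset.sum_congr rfl hNK, ← Finset.smul_sum, hqp, ← smul_add, Matrix.mul_smul] at h
    refine eq_zero_of_mul_smul_one_add_eq_zero (c := 1) PadicInt.prime_p
      PadicInt.prime_p.not_dvd_one (sum_mem hK) ?_
    rw [one_smul]
    exact (smul_eq_zero.mp h).resolve_left PadicInt.prime_p.ne_zero
  · refine eq_zero_of_mul_smul_one_add_eq_zero PadicInt.prime_p ?_ (sum_mem fun k _ =>
      nsmul_mem (pow_succ_mem_strictUpperMod hN k) _) h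
    intro hdvd
    rw [← PadicInt.norm_lt_one_iff_dvd, PadicInt.norm_natCast_lt_one_iff] at hdvd
    exact hqp ((Nat.prime_dvd_prime_iff_eq hpp hq).mp hdvd).symm

theorem pow_sub_one_mem_strictUpperMod {R : Type*} [CommRing R] {π : R}
    {A : Matrix (Fin 2) (Fin 2) R} (hA : A - 1 ∈ strictUpperMod π) (n : ℕ) :
    A ^ n - 1 ∈ strictUpperMod π := by
  induction n with
  | zero => simp
  | succ n ih =>
    rw [show A ^ (n + 1) - 1 = (A ^ n - 1) * (A - 1) + (A ^ n - 1) + (A - 1) by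
      rw [pow_succ]; noncomm_ring]
    exact add_mem (add_mem (mul_mem ih hA) ih) hA

theorem eq_one_of_pow_eq_one_of_sub_one_mem_strictUpperMod {p : ℕ} [Fact p.Prime] (hp : 5 ≤ p)
    {n : ℕ} (hn : n ≠ 0) {A : Matrix (Fin 2) (Fin 2) ℤ_[p]}
    (hA : A - 1 ∈ strictUpperMod (p : ℤ_[p])) (h : A ^ n = 1) : A = 1 := by
  induction n using Nat.recOnMul generalizing A with
  | zero => exact absurd rfl hn
  | one => simpa using h
  | prime q hq =>
    exact sub_eq_zero.mp (eq_zero_of_one_add_pow_prime_eq_one hp hA hq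
      (by rwa [add_sub_cancel]))
  | mul a b iha ihb =>
    obtain ⟨ha, hb⟩ := mul_ne_zero_iff.mp hn
    rw [pow_mul] at h
    exact iha ha hA (ihb hb (pow_sub_one_mem_strictUpperMod hA a) h)

/-- For a prime `p ≥ 5`, the pro-`p` Iwahori subgroup of `SL₂(ℤ_p)` (matrices that are
upper-triangular unipotent mod `p`) is torsion-free: if `A` lies in it and `Aⁿ = 1` for
some `n ≥ 1`, then `A = 1`. -/
theorem proPIwahori_torsionFree (p : ℕ) [Fact p.Prime] (hp : 5 ≤ p)
    (A : Matrix.SpecialLinearGroup (Fin 2) ℤ_[p])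
    (h00 : (p : ℤ_[p]) ∣ ((A : Matrix (Fin 2) (Fin 2) ℤ_[p]) 0 0 - 1))
    (h11 : (p : ℤ_[p]) ∣ ((A : Matrix (Fin 2) (Fin 2) ℤ_[p]) 1 1 - 1))
    (h10 : (p : ℤ_[p]) ∣ ((A : Matrix (Fin 2) (Fin 2) ℤ_[p]) 1 0))
    (n : ℕ) (hn : 1 ≤ n) (hA : A ^ n = 1) : A = 1 := by
  refine Subtype.ext (eq_one_of_pow_eq_one_of_sub_one_mem_strictUpperMod hp
    (Nat.one_le_iff_ne_zero.mp hn)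
    (mem_strictUpperMod.mpr ⟨by simpa using h00, by simpa using h11, by simpa using h10⟩) ?_)
  simpa using congrArg Subtype.val hA
end
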